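/- For \(p > 2\): \(K_{p^\infty} \cap K_\infty = K\); the Galois group \(\hat G = \mathrm{Gal}(K_{\infty,p^\infty}/K)\) decomposes as a semidirect product \(\hat G = G_0 \rtimes H_K\), where \(G_0 = \mathrm{Gal}(K_{\infty,p^\infty}/K_{p^\infty})\) and \(H_K = \mathrm{Gal}(K_{\infty,p^\infty}/K_\infty)\); and \(G_0 \simeq \mathbb Z_p(1)\) (in particular \(G_0\) is topologically isomorphic to the additive group \(\mathbb Z_p\)). -/

import Mathlib

set_option autoImplicit false

/-- An automorphism fixing the generators fixes the generated fields. -/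
lemma aux_mem_fixing {K L : Type} [Field K] [Field L] [Algebra K L] (x : ℕ → L)
    (g : L ≃ₐ[K] L) :
    g ∈ (⨆ n : ℕ, IntermediateField.adjoin K ({x n} : Set L)).fixingSubgroup ↔
      ∀ n, g (x n) = x n := by
  constructor
  · intro h n
    rw [IntermediateField.mem_fixingSubgroup_iff] at h
    exact h _ ((le_iSup (fun n : ℕ => IntermediateField.adjoin K ({x n} : Set L)) n)
      (IntermediateField.mem_adjoin_simple_self K (x n)))
  · intro h
    have key : (⨆ n : ℕ, IntermediateField.adjoin K ({x n} : Set L)) ≤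
        IntermediateField.fixedField (Subgroup.zpowers g) := by
      refine iSup_le fun n => ?_
      rw [IntermediateField.adjoin_simple_le_iff, IntermediateField.mem_fixedField_iff]
      intro f hf
      have : Subgroup.zpowers g ≤ MulAction.stabilizer (L ≃ₐ[K] L) (x n) := by
        rw [Subgroup.zpowers_le]
        exact h n
      exact this hf
    rw [IntermediateField.le_iff_le] at key
    exact key (Subgroup.mem_zpowers g)

/-- An irreducible element of the ring of integers is not a `p`-th power up to a root of unity. -/
lemma aux_irreducible {A K : Type} [CommRing A] [Field K] [Algebra A K] (p N : ℕ) (hp : 2 ≤ p)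
    (hN : 0 < N)
    (πK : K) (hmem : πK ∈ integralClosure A K)
    (hunif : Irreducible (⟨πK, hmem⟩ : integralClosure A K))
    (y u : K) (hu : u ^ N = 1) (hy : y ^ p = u * πK) : False := by
  have hu' : u ∈ integralClosure A K := by
    refine IsIntegral.of_pow hN ?_
    rw [hu]; exact isIntegral_one
  have hy' : y ∈ integralClosure A K := by
    refine IsIntegral.of_pow (n := p) (by omega) ?_
    rw [hy]; exact IsIntegral.mul hu' hmem
  set U : integralClosure A K := ⟨u, hu'⟩
  set Y : integralClosure A K := ⟨y, hy'⟩
  set P : integralClosure A K := ⟨πK, hmem⟩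
  have hU : U ^ N = 1 := Subtype.ext hu
  have hY : Y ^ p = U * P := Subtype.ext hy
  have hUu : IsUnit U := .of_pow_eq_one hU hN.ne'
  have hirr : Irreducible (Y ^ p) := by
    rw [hY]; exact (irreducible_isUnit_mul hUu).mpr hunif
  exact not_irreducible_pow (by omega) hirr

/-- `π_1` does not lie in `K_{p^∞}`. -/
lemma aux_not_mem {A K L : Type} [CommRing A] [Field K] [Field L] [Algebra A K] [Algebra K L]
    [IsGalois K L]
    (p : ℕ) [Fact (Nat.Prime p)] (hp : 2 < p)
    (πK : K) (hmem : πK ∈ integralClosure A K)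
    (hunif : Irreducible (⟨πK, hmem⟩ : integralClosure A K))
    (α : L) (hα : α ^ p = algebraMap K L πK) (n : ℕ) (z : L) (hz : IsPrimitiveRoot z (p ^ n)) :
    α ∉ IntermediateField.adjoin K ({z} : Set L) := by
  intro hmemα
  have hpp : p.Prime := Fact.out
  have hπ0 : πK ≠ 0 := fun h => hunif.ne_zero (Subtype.ext h)
  have hα0 : α ≠ 0 := by
    rintro rfl
    rw [zero_pow hpp.ne_zero, eq_comm, map_eq_zero] at hα
    exact hπ0 hα
  have hz0 : z ≠ 0 := hz.ne_zero (pow_ne_zero _ hpp.ne_zero)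
  have := ZMod.isCyclic_units_of_prime_pow p hpp (by omega) n
  -- a generator of the image of Galois
  obtain ⟨⟨s, hs⟩, hgen⟩ := IsCyclic.exists_generator (α := (hz.autToPow K).range)
  obtain ⟨σ, rfl⟩ := hs
  have hfix : ∀ y ∈ IntermediateField.adjoin K ({z} : Set L), σ y = y →
      ∃ y0 : K, algebraMap K L y0 = y := by
    intro y hy hσy
    apply (InfiniteGalois.mem_range_algebraMap_iff_fixed (k := K) y).mpr
    intro g
    obtain ⟨k, hk⟩ := hgen ⟨hz.autToPow K g, ⟨g, rfl⟩⟩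
    have hk' : hz.autToPow K (σ ^ k) = hz.autToPow K g := by
      simpa using congrArg Subtype.val hk
    have hgz : ((σ ^ k)⁻¹ * g) z = z := by
      have : g z = (σ ^ k) z := by
        rw [← hz.autToPow_spec K, ← hz.autToPow_spec K, hk']
      rw [AlgEquiv.mul_apply, this, ← AlgEquiv.mul_apply, inv_mul_cancel, AlgEquiv.one_apply]
    have h1 : ((σ ^ k)⁻¹ * g) ∈ (IntermediateField.adjoin K ({z} : Set L)).fixingSubgroup := by
      have := (aux_mem_fixing (K := K) (fun _ : ℕ => z) ((σ ^ k)⁻¹ * g)).mpr (fun _ => hgz)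
      simpa using this
    have h2 : ((σ ^ k)⁻¹ * g) y = y := (IntermediateField.mem_fixingSubgroup_iff _ _).mp h1 y hy
    have h3 : (σ ^ k) y = y := by
      have : Subgroup.zpowers σ ≤ MulAction.stabilizer (L ≃ₐ[K] L) y := by
        rw [Subgroup.zpowers_le]
        exact hσy
      exact this ⟨k, rfl⟩
    calc g y = (σ ^ k) (((σ ^ k)⁻¹ * g) y) := by
          rw [← AlgEquiv.mul_apply, mul_inv_cancel_left]
      _ = y := by rw [h2, h3]
  have hσα : (σ α / α) ^ p = 1 := by
    rw [div_pow, ← map_pow, hα, AlgEquiv.commutes, div_self]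
    rw [← hα]; exact pow_ne_zero _ hα0
  -- find the twist
  have htwist : ∃ e : ℕ, σ (z ^ e * α) = z ^ e * α := by
    have hex : ∃ j, σ (z ^ p ^ j) = z ^ p ^ j := ⟨n, by rw [hz.pow_eq_one, map_one]⟩
    classical
    rcases hj : Nat.find hex with _ | j
    · -- `σ` is trivial on `K(z)`
      have h0 : σ z = z := by
        have := Nat.find_spec hex
        rw [hj] at this
        simpa using this
      have h1 : σ ∈ (IntermediateField.adjoin K ({z} : Set L)).fixingSubgroup := by
        have := (aux_mem_fixing (K := K) (fun _ : ℕ => z) σ).mpr (fun _ => h0)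
        simpa using this
      refine ⟨0, ?_⟩
      simpa using (IntermediateField.mem_fixingSubgroup_iff _ _).mp h1 α hmemα
    · have h1 := Nat.find_spec hex
      rw [hj] at h1
      have h2 : ¬ σ (z ^ p ^ j) = z ^ p ^ j := Nat.find_min hex (by omega)
      set x := z ^ p ^ j with hx
      have hx0 : x ≠ 0 := pow_ne_zero _ hz0
      rw [pow_succ, pow_mul, ← hx] at h1
      have hw1 : (σ x / x) ^ p = 1 := by
        rw [div_pow, ← map_pow, h1, div_self (pow_ne_zero _ hx0)]
      have hw2 : σ x / x ≠ 1 := by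
        rw [Ne, div_eq_one_iff_eq hx0]; exact h2
      have hw : IsPrimitiveRoot (σ x / x) p := by
        have := IsPrimitiveRoot.orderOf (σ x / x)
        rwa [orderOf_eq_prime hw1 hw2] at this
      obtain ⟨i, hi, hi'⟩ := hw.eq_pow_of_pow_eq_one hσα
      refine ⟨p ^ j * (p - i), ?_⟩
      rw [pow_mul, ← hx]
      have e1 : σ x = (σ x / x) * x := by field_simp
      have e2 : σ α = (σ x / x) ^ i * α := by rw [hi']; field_simp
      rw [map_mul, map_pow, e2]
      nth_rewrite 1 [e1]
      rw [mul_pow]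
      have e3 : (σ x / x) ^ (p - i) * (σ x / x) ^ i = 1 := by
        rw [← pow_add, Nat.sub_add_cancel hi.le, hw1]
      linear_combination (x ^ (p - i) * α) * e3
  obtain ⟨e, he⟩ := htwist
  obtain ⟨y, hy⟩ := hfix (z ^ e * α)
    (mul_mem (pow_mem (IntermediateField.mem_adjoin_simple_self K z) e) hmemα) he
  have hu : algebraMap K L (y ^ p / πK) = (z ^ e) ^ p := by
    rw [map_div₀, map_pow, hy, mul_pow, hα, mul_div_assoc, div_self, mul_one]
    simpa using hπ0
  refine aux_irreducible p (p ^ n) hp.le (pow_pos hpp.pos n) πK hmem hunif y (y ^ p / πK) ?_ ?_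
  · apply (algebraMap K L).injective
    rw [map_pow, hu, map_one, ← pow_mul, ← pow_mul, ← mul_assoc, mul_comm (e * p), pow_mul, hz.pow_eq_one, one_pow]
  · field_simp

lemma aux_pow_val {L : Type} [Field L] (N : ℕ) [NeZero N] (w : L) (hw : w ^ N = 1) (k : ℕ)
    (a : ZMod N) (h : (k : ZMod N) = a) : w ^ k = w ^ a.val := by
  subst h
  rw [ZMod.val_natCast]
  exact pow_eq_pow_mod k hw

/-- The Kummer cocycle: existence. -/
lemma aux_kummer {K L : Type} [Field K] [Field L] [Algebra K L]
    (p : ℕ) [Fact (Nat.Prime p)] (π : ℕ → L) (hne : ∀ n, π n ≠ 0)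
    (hπ : ∀ n : ℕ, (π (n + 1)) ^ p = π n)
    (ε : ℕ → L) (hε : ∀ n : ℕ, IsPrimitiveRoot (ε n) (p ^ n))
    (hεc : ∀ n, ε (n + 1) ^ p = ε n)
    (hfix0 : ∀ g : L ≃ₐ[K] L, g (π 0) = π 0) (g : L ≃ₐ[K] L) :
    ∃ c : ℤ_[p], ∀ n, g (π n) = ε n ^ (PadicInt.toZModPow n c).val * π n := by
  have hpp : p.Prime := Fact.out
  have hpow : ∀ n, π n ^ p ^ n = π 0 := by
    intro n
    induction n with
    | zero => simp
    | succ n ih => rw [pow_succ', pow_mul, hπ, ih]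
  have h1 : ∀ n, ∃ k < p ^ n, ε n ^ k = g (π n) / π n := by
    intro n
    have : NeZero (p ^ n) := ⟨pow_ne_zero _ hpp.ne_zero⟩
    apply (hε n).eq_pow_of_pow_eq_one
    rw [div_pow, ← map_pow, hpow, hfix0, div_self (hne 0)]
  choose k hk hk' using h1
  have hdvd : ∀ i, (p : ℤ) ^ i ∣ (k (i + 1) : ℤ) - k i := by
    intro i
    have : ε i ^ k (i + 1) = ε i ^ k i := by
      rw [hk', ← hεc i, ← pow_mul, mul_comm, pow_mul, hk', div_pow, ← map_pow, hπ]
    rw [pow_eq_pow_mod (k (i + 1)) (hε i).pow_eq_one] at this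
    have h2 := (hε i).pow_inj (Nat.mod_lt _ (pow_pos hpp.pos i)) (hk i) this
    have h3 : k i ≡ k (i + 1) [MOD p ^ i] := by
      rw [Nat.ModEq, h2, Nat.mod_eq_of_lt (hk i)]
    simpa using h3.dvd
  refine ⟨PadicInt.ofIntSeq _ (PadicInt.isCauSeq_padicNorm_of_pow_dvd_sub
    (fun n => (k n : ℤ)) p hdvd), fun n => ?_⟩
  have : NeZero (p ^ n) := ⟨pow_ne_zero _ hpp.ne_zero⟩
  rw [PadicInt.toZModPow_ofIntSeq_of_pow_dvd_sub (fun n => (k n : ℤ)) p hdvd n,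
    ← aux_pow_val (p ^ n) (ε n) (hε n).pow_eq_one (k n) _ (by simp), hk', div_mul_cancel₀ _ (hne n)]


/-- Let `p > 2`, `K` a finite extension of `ℚ_p` with uniformizer `π`
(an irreducible element of its ring of integers), `π_n` compatible `p^n`-th roots of `π`
and `ζ_{p^n}` primitive `p^n`-th roots of unity inside `L = K_{∞,p^∞} = ⋃ₙ K(π_n, ζ_{p^n})`,
which is Galois over `K`.  Set `K_∞ = ⋃ₙ K(π_n)` and `K_{p^∞} = ⋃ₙ K(ζ_{p^n})`.  Then:
`K_{p^∞} ∩ K_∞ = K`; the Galois group `Ĝ = Gal(K_{∞,p^∞}/K)` is the (internal)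
semidirect product `G₀ ⋊ H_K`, where `G₀ = Gal(K_{∞,p^∞}/K_{p^∞})` is normal and
`H_K = Gal(K_{∞,p^∞}/K_∞)`; and `G₀ ≃ ℤ_p(1)`, in particular `G₀` is topologically
isomorphic to the additive group `ℤ_p`. -/
theorem lattice_semistable_Ghat_semidirect_product
    (p : ℕ) [Fact (Nat.Prime p)] (hp : 2 < p)
    (K L : Type) [Field K] [Field L]
    [Algebra ℚ_[p] K] [FiniteDimensional ℚ_[p] K]
    [Algebra ℤ_[p] K] [IsScalarTower ℤ_[p] ℚ_[p] K]
    [Algebra K L] [IsGalois K L]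
    (πK : K) (hmem : πK ∈ integralClosure ℤ_[p] K)
    (hunif : Irreducible (⟨πK, hmem⟩ : integralClosure ℤ_[p] K))
    (π : ℕ → L) (hπ0 : π 0 = algebraMap K L πK)
    (hπ : ∀ n : ℕ, (π (n + 1)) ^ p = π n)
    (ζ : ℕ → L) (hζ : ∀ n : ℕ, IsPrimitiveRoot (ζ n) (p ^ n))
    -- `K_∞ = ⋃ₙ K(π_n)` and `K_{p^∞} = ⋃ₙ K(ζ_{p^n})` inside `L`
    (Kinf Kpinf : IntermediateField K L)
    (hKinf : Kinf = ⨆ n : ℕ, IntermediateField.adjoin K ({π n} : Set L))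
    (hKpinf : Kpinf = ⨆ n : ℕ, IntermediateField.adjoin K ({ζ n} : Set L))
    -- `L = K_{∞,p^∞}` is the compositum
    (htop : Kinf ⊔ Kpinf = ⊤) :
    -- `K_{p^∞} ∩ K_∞ = K`
    Kpinf ⊓ Kinf = ⊥ ∧
    -- `Ĝ = G₀ ⋊ H_K` (internal semidirect product), with `G₀` normal
    (Kpinf.fixingSubgroup).Normal ∧
    Kpinf.fixingSubgroup ⊓ Kinf.fixingSubgroup = ⊥ ∧
    Kpinf.fixingSubgroup ⊔ Kinf.fixingSubgroup = ⊤ ∧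
    -- `G₀ ≃ ℤ_p(1)`: topologically isomorphic to (the additive group of) `ℤ_p`
    ∃ e : Kpinf.fixingSubgroup ≃* Multiplicative ℤ_[p],
      Continuous ⇑e ∧ Continuous ⇑e.symm := by
  have hpp : p.Prime := Fact.out
  have hπK0 : πK ≠ 0 := fun h => hunif.ne_zero (Subtype.ext h)
  have hne : ∀ n, π n ≠ 0 := by
    intro n
    induction n with
    | zero => rw [hπ0]; simpa using hπK0
    | succ n ih =>
      intro h
      apply ih
      rw [← hπ, h, zero_pow hpp.ne_zero]
  have hfix0 : ∀ g : L ≃ₐ[K] L, g (π 0) = π 0 := by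
    intro g; rw [hπ0, AlgEquiv.commutes]
  have hNZ : ∀ n, NeZero (p ^ n) := fun n => ⟨pow_ne_zero _ hpp.ne_zero⟩
  have memG0 : ∀ g : L ≃ₐ[K] L, g ∈ Kpinf.fixingSubgroup ↔ ∀ n, g (ζ n) = ζ n := by
    intro g; rw [hKpinf]; exact aux_mem_fixing ζ g
  have memH : ∀ g : L ≃ₐ[K] L, g ∈ Kinf.fixingSubgroup ↔ ∀ n, g (π n) = π n := by
    intro g; rw [hKinf]; exact aux_mem_fixing π g
  -- `π 1` is not in `K_{p^∞}`
  have hnot : π 1 ∉ Kpinf := by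
    intro h
    have hdir : Directed (· ≤ ·) (fun n : ℕ => IntermediateField.adjoin K ({ζ n} : Set L)) := by
      apply Monotone.directed_le
      intro a b hab
      change IntermediateField.adjoin K _ ≤ IntermediateField.adjoin K _
      rw [IntermediateField.adjoin_simple_le_iff]
      have h1 : ζ a ^ p ^ b = 1 := by
        obtain ⟨d, rfl⟩ := Nat.exists_eq_add_of_le hab
        rw [pow_add, pow_mul, (hζ a).pow_eq_one, one_pow]
      have := hNZ b
      obtain ⟨i, -, hi⟩ := (hζ b).eq_pow_of_pow_eq_one h1
      rw [← hi]
      exact pow_mem (IntermediateField.mem_adjoin_simple_self K _) _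
    rw [hKpinf, ← SetLike.mem_coe, IntermediateField.coe_iSup_of_directed hdir,
      Set.mem_iUnion] at h
    obtain ⟨n, hn⟩ := h
    exact aux_not_mem p hp πK hmem hunif (π 1) (by rw [← hπ0, ← hπ 0]) n (ζ n) (hζ n) hn
  obtain ⟨γ, hγ, hγ1⟩ : ∃ γ ∈ Kpinf.fixingSubgroup, γ (π 1) ≠ π 1 := by
    by_contra! hcon
    apply hnot
    rw [← InfiniteGalois.fixedField_fixingSubgroup Kpinf, IntermediateField.mem_fixedField_iff]
    exact hcon
  have hpow : ∀ n, π n ^ p ^ n = π 0 := by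
    intro n
    induction n with
    | zero => simp
    | succ n ih => rw [pow_succ', pow_mul, hπ, ih]
  -- the compatible system of roots of unity
  obtain ⟨ε, hεdef⟩ : ∃ ε : ℕ → L, ∀ n, ε n = γ (π n) / π n := ⟨_, fun _ => rfl⟩
  have hεc : ∀ n, ε (n + 1) ^ p = ε n := by
    intro n; rw [hεdef, hεdef, div_pow, ← map_pow, hπ]
  have hε1 : ∀ n, ε n ^ p ^ n = 1 := by
    intro n; rw [hεdef, div_pow, ← map_pow, hpow, hfix0, div_self (hne 0)]
  have hεp : ∀ n, ε (n + 1) ^ p ^ n = ε 1 := by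
    intro n
    induction n with
    | zero => simp
    | succ n ih => rw [pow_succ', pow_mul, hεc, ih]
  have hε : ∀ n, IsPrimitiveRoot (ε n) (p ^ n) := by
    intro n
    rcases n with _ | n
    · have := hε1 0
      simp only [pow_zero, pow_one] at this
      rw [this, pow_zero]
      exact IsPrimitiveRoot.one
    · have := IsPrimitiveRoot.orderOf (ε (n + 1))
      rwa [orderOf_eq_prime_pow (p := p) (n := n) _ (hε1 (n + 1))] at this
      rw [hεp, hεdef, div_eq_one_iff_eq (hne 1)]
      exact hγ1
  have hεG0 : ∀ g ∈ Kpinf.fixingSubgroup, ∀ n, g (ε n) = ε n := by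
    intro g hg n
    have := hNZ n
    obtain ⟨i, -, hi⟩ := (hζ n).eq_pow_of_pow_eq_one (hε1 n)
    rw [← hi, map_pow, (memG0 g).mp hg]
  choose c hc using fun g : L ≃ₐ[K] L => aux_kummer p π hne hπ ε hε hεc hfix0 g
  have huniq : ∀ (n : ℕ) (a b : ZMod (p ^ n)), ε n ^ a.val * π n = ε n ^ b.val * π n → a = b := by
    intro n a b h
    have := hNZ n
    apply ZMod.val_injective
    exact (hε n).pow_inj (ZMod.val_lt a) (ZMod.val_lt b) (mul_right_cancel₀ (hne n) h)
  have hadd : ∀ (n : ℕ) (a b : ZMod (p ^ n)), ε n ^ (a + b).val = ε n ^ a.val * ε n ^ b.val := by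
    intro n a b
    have := hNZ n
    rw [← pow_add]
    exact (aux_pow_val (p ^ n) (ε n) (hε1 n) _ _ (by simp)).symm
  -- trivial intersection
  have hinf : Kpinf.fixingSubgroup ⊓ Kinf.fixingSubgroup = ⊥ := by
    rw [← IntermediateField.fixingSubgroup_sup, sup_comm, htop,
      IntermediateField.fixingSubgroup_top]
  -- the homomorphism
  let f : Kpinf.fixingSubgroup →* Multiplicative ℤ_[p] :=
    MonoidHom.mk' (fun g => Multiplicative.ofAdd (c g.1)) (by
      intro g h
      rw [← ofAdd_add]
      congr 1
      apply PadicInt.ext_of_toZModPow.mp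
      intro n
      apply huniq
      rw [← hc, Subgroup.coe_mul, AlgEquiv.mul_apply, hc h.1, map_mul, map_pow,
        hεG0 g.1 g.2, hc g.1, map_add, hadd]
      ring)
  have hfc : ∀ g, f g = Multiplicative.ofAdd (c g.1) := fun _ => rfl
  have hagree : ∀ g h : L ≃ₐ[K] L, c g = c h → g⁻¹ * h ∈ Kinf.fixingSubgroup := by
    intro g h hgh
    rw [memH]
    intro n
    have : h (π n) = g (π n) := by rw [hc, hc, hgh]
    rw [AlgEquiv.mul_apply, this, ← AlgEquiv.mul_apply, inv_mul_cancel, AlgEquiv.one_apply]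
  have hinj : Function.Injective f := by
    intro g h hgh
    have h1 : c g.1 = c h.1 := by simpa [hfc] using hgh
    have h2 : g.1⁻¹ * h.1 ∈ Kpinf.fixingSubgroup ⊓ Kinf.fixingSubgroup :=
      Subgroup.mem_inf.mpr ⟨mul_mem (inv_mem g.2) h.2, hagree _ _ h1⟩
    rw [hinf, Subgroup.mem_bot, inv_mul_eq_one] at h2
    exact Subtype.ext h2
  have hcc : Continuous c := by
    rw [Metric.continuous_iff']
    intro g δ hδ
    obtain ⟨n, hn⟩ := PadicInt.exists_pow_neg_lt p hδ
    have hopen : {h : L ≃ₐ[K] L | (g⁻¹ * h) ∈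
        (MulAction.stabilizer (L ≃ₐ[K] L) (π n) : Set (L ≃ₐ[K] L))} ∈ nhds g := by
      apply IsOpen.mem_nhds
      · exact (stabilizer_isOpen_of_isIntegral (K := K) (π n)).preimage (continuous_const_mul g⁻¹)
      · simp
    filter_upwards [hopen] with h hh
    have h1 : (g⁻¹ * h) (π n) = π n := hh
    have h2 : h (π n) = g (π n) := by
      rw [← h1, ← AlgEquiv.mul_apply g, mul_inv_cancel_left]
      exact congrArg h h1
    refine lt_of_le_of_lt ?_ hn
    rw [dist_eq_norm, PadicInt.norm_le_pow_iff_mem_span_pow, ← PadicInt.ker_toZModPow,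
      RingHom.mem_ker, map_sub, sub_eq_zero]
    apply huniq
    rw [← hc, ← hc, h2]
  have hfcont : Continuous f := by
    have : Continuous fun g : Kpinf.fixingSubgroup => Multiplicative.ofAdd (c g.1) :=
      continuous_ofAdd.comp (hcc.comp continuous_subtype_val)
    exact this
  have : CompactSpace Kpinf.fixingSubgroup :=
    isCompact_iff_compactSpace.mp (InfiniteGalois.fixingSubgroup_isClosed Kpinf).isCompact
  have hsurj : Function.Surjective f := by
    have hγc : c γ = 1 := by
      apply PadicInt.ext_of_toZModPow.mp
      intro n
      apply huniq
      have := hNZ n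
      rw [← hc, map_one, ← aux_pow_val (p ^ n) (ε n) (hε1 n) 1 1 (by simp), pow_one, hεdef,
        div_mul_cancel₀ _ (hne n)]
    have hclosed : IsClosed (Set.range fun g : Kpinf.fixingSubgroup => c g.1) :=
      (isCompact_range (hcc.comp continuous_subtype_val)).isClosed
    have hsub : Set.range (Nat.cast : ℕ → ℤ_[p]) ⊆
        Set.range fun g : Kpinf.fixingSubgroup => c g.1 := by
      rintro _ ⟨k, rfl⟩
      refine ⟨(⟨γ, hγ⟩ : Kpinf.fixingSubgroup) ^ k, ?_⟩
      have h1 : f ((⟨γ, hγ⟩ : Kpinf.fixingSubgroup) ^ k) = Multiplicative.ofAdd (k : ℤ_[p]) := by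
        rw [map_pow, hfc, hγc, ← ofAdd_nsmul, nsmul_one]
      exact Multiplicative.ofAdd.injective h1
    intro x
    have hx : Multiplicative.toAdd x ∈ Set.range fun g : Kpinf.fixingSubgroup => c g.1 :=
      hclosed.closure_subset_iff.mpr hsub (PadicInt.denseRange_natCast _)
    obtain ⟨g, hg⟩ := hx
    exact ⟨g, Multiplicative.toAdd.injective hg⟩
  have hsup : Kpinf.fixingSubgroup ⊔ Kinf.fixingSubgroup = ⊤ := by
    rw [eq_top_iff]
    intro g _
    obtain ⟨τ, hτ⟩ := hsurj (Multiplicative.ofAdd (c g))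
    have h1 : c τ.1 = c g := Multiplicative.ofAdd.injective hτ
    have := Subgroup.mul_mem_sup τ.2 (hagree _ _ h1)
    rwa [mul_inv_cancel_left] at this
  refine ⟨?_, ?_, hinf, hsup, MulEquiv.ofBijective f ⟨hinj, hsurj⟩, hfcont, ?_⟩
  · rw [eq_bot_iff]
    intro x hx
    rw [InfiniteGalois.mem_bot_iff_fixed]
    have : Kpinf.fixingSubgroup ⊔ Kinf.fixingSubgroup ≤ MulAction.stabilizer (L ≃ₐ[K] L) x := by
      rw [sup_le_iff]
      constructor
      · intro g hg
        exact (IntermediateField.mem_fixingSubgroup_iff _ _).mp hg x hx.1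
      · intro g hg
        exact (IntermediateField.mem_fixingSubgroup_iff _ _).mp hg x hx.2
    rw [hsup] at this
    exact fun g => this (Subgroup.mem_top g)
  · refine ⟨fun g hg h => ?_⟩
    rw [memG0]
    intro n
    have := hNZ n
    have h1 : (h⁻¹ (ζ n)) ^ p ^ n = 1 := by rw [← map_pow, (hζ n).pow_eq_one, map_one]
    obtain ⟨i, -, hi⟩ := (hζ n).eq_pow_of_pow_eq_one h1
    have h2 : g (h⁻¹ (ζ n)) = h⁻¹ (ζ n) := by
      rw [← hi, map_pow, (memG0 g).mp hg]
    rw [AlgEquiv.mul_apply, AlgEquiv.mul_apply, h2, ← AlgEquiv.mul_apply, mul_inv_cancel,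
      AlgEquiv.one_apply]
  · exact Continuous.continuous_symm_of_equiv_compact_to_t2
      (f := (MulEquiv.ofBijective f ⟨hinj, hsurj⟩).toEquiv) hfcont
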